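/- Fix a convex set K ⊆ ℝ with min K = 0 and a continuous map I : B₀(Σ,K) → ℝ. The following are equivalent: (i) I is monotone, normalized, and positively superhomogeneous; (ii) for every φ ∈ B₀(Σ,K) there exists a family Φ_φ of monotone, sublinear real-valued functionals on B₀(Σ,K) such that I(φ) = min_{J∈Φ_φ} J(φ) (minimum attained), min_{J∈Φ_φ} J(k·1_S) = k for all k ∈ K, and Φ_{φ₁} ⊆ Φ_{φ₂} whenever φ₁ ≥ φ₂ pointwise; (iii) for every φ ∈ B₀(Σ,K) there exists a family Ψ_φ of monotone, superlinear real-valued functionals on B₀(Σ,K) such that I(φ) = max_{H∈Ψ_φ} H(φ) (maximum attained), max_{H∈Ψ_φ} H(k·1_S) = k for all k ∈ K, and Ψ_{φ₁} ⊆ Ψ_{φ₂} whenever φ₂ ≥ φ₁ pointwise. -/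

import Mathlib

variable {S : Type*} [MeasurableSpace S]

/-- `B₀(Σ,K)`: the set of Σ-measurable simple (finite-range) functions `φ : S → ℝ`
with values in `K`. -/
def B0 (K : Set ℝ) : Set (S → ℝ) :=
  {φ | Measurable φ ∧ (Set.range φ).Finite ∧ Set.range φ ⊆ K}

/-- `I` is monotone on `B₀(Σ,K)`. -/
def MonotoneOnB0 (K : Set ℝ) (I : (S → ℝ) → ℝ) : Prop :=
  ∀ φ : S → ℝ, φ ∈ B0 K → ∀ ψ : S → ℝ, ψ ∈ B0 K → (∀ s, ψ s ≤ φ s) → I ψ ≤ I φ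

/-- `I` is normalized on `B₀(Σ,K)`. -/
def NormalizedOnB0 (K : Set ℝ) (I : (S → ℝ) → ℝ) : Prop :=
  ∀ k ∈ K, I (fun _ => k) = k

/-- `I` is continuous on `B₀(Σ,K)` with respect to the supremum norm. -/
def SupNormContinuous (K : Set ℝ) (I : (S → ℝ) → ℝ) : Prop :=
  ∀ φ : S → ℝ, φ ∈ B0 K → ∀ ε : ℝ, 0 < ε → ∃ δ > (0 : ℝ), ∀ ψ : S → ℝ, ψ ∈ B0 K →
    (∀ s, |ψ s - φ s| ≤ δ) → |I ψ - I φ| ≤ ε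

/-- `I` is positively superhomogeneous on `B₀(Σ,K)`. -/
def PosSuperhom (K : Set ℝ) (I : (S → ℝ) → ℝ) : Prop :=
  ∀ γ : ℝ, γ ∈ Set.Ioo (0 : ℝ) 1 → ∀ φ : S → ℝ, φ ∈ B0 K →
    (fun s => γ * φ s) ∈ B0 K → I (fun s => γ * φ s) ≤ γ * I φ

/-- `I` is positively homogeneous on `B₀(Σ,K)`. -/
def PosHomOnB0 (K : Set ℝ) (I : (S → ℝ) → ℝ) : Prop :=
  ∀ lam : ℝ, 0 < lam → ∀ φ : S → ℝ, φ ∈ B0 K → (fun s => lam * φ s) ∈ B0 K →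
    I (fun s => lam * φ s) = lam * I φ

/-- `I` is subadditive on `B₀(Σ,K)`. -/
def SubaddOnB0 (K : Set ℝ) (I : (S → ℝ) → ℝ) : Prop :=
  ∀ φ : S → ℝ, φ ∈ B0 K → ∀ ψ : S → ℝ, ψ ∈ B0 K → (fun s => φ s + ψ s) ∈ B0 K →
    I (fun s => φ s + ψ s) ≤ I φ + I ψ

/-- `I` is superadditive on `B₀(Σ,K)`. -/
def SuperaddOnB0 (K : Set ℝ) (I : (S → ℝ) → ℝ) : Prop :=
  ∀ φ : S → ℝ, φ ∈ B0 K → ∀ ψ : S → ℝ, ψ ∈ B0 K → (fun s => φ s + ψ s) ∈ B0 K →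
    I φ + I ψ ≤ I (fun s => φ s + ψ s)

/-- `I` is sublinear: positively homogeneous and subadditive. -/
def SublinearOnB0 (K : Set ℝ) (I : (S → ℝ) → ℝ) : Prop :=
  PosHomOnB0 K I ∧ SubaddOnB0 K I

/-- `I` is superlinear: positively homogeneous and superadditive. -/
def SuperlinearOnB0 (K : Set ℝ) (I : (S → ℝ) → ℝ) : Prop :=
  PosHomOnB0 K I ∧ SuperaddOnB0 K I

theorem B0.nonneg {K : Set ℝ} (hmin : IsLeast K 0) {φ : S → ℝ} (hφ : φ ∈ B0 K) (s : S) :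
    0 ≤ φ s :=
  hmin.2 (hφ.2.2 ⟨s, rfl⟩)

theorem B0.const_mem {K : Set ℝ} {k : ℝ} (hk : k ∈ K) : (fun _ : S => k) ∈ B0 K :=
  ⟨measurable_const, Set.finite_range_const, by rintro _ ⟨s, rfl⟩; exact hk⟩

theorem B0.exists_max {K : Set ℝ} [Nonempty S] {φ : S → ℝ} (hφ : φ ∈ B0 K) :
    ∃ s, ∀ t, φ t ≤ φ s := by
  obtain ⟨_, ⟨s, rfl⟩, h⟩ := Set.exists_max_image _ id hφ.2.1 (Set.range_nonempty φ)
  exact ⟨s, fun t => h _ ⟨t, rfl⟩⟩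

theorem B0.exists_min {K : Set ℝ} [Nonempty S] {φ : S → ℝ} (hφ : φ ∈ B0 K) :
    ∃ s, ∀ t, φ s ≤ φ t := by
  obtain ⟨_, ⟨s, rfl⟩, h⟩ := Set.exists_min_image _ id hφ.2.1 (Set.range_nonempty φ)
  exact ⟨s, fun t => h _ ⟨t, rfl⟩⟩

/-- A nonnegative multiple of an element of `B₀(Σ,K)` dominated by another element lies in
`B₀(Σ,K)`. -/
theorem B0.mul_mem {K : Set ℝ} (hK : Convex ℝ K) (hmin : IsLeast K 0) {φ ψ : S → ℝ}
    (hφ : φ ∈ B0 K) (hψ : ψ ∈ B0 K) {c : ℝ} (hc : 0 ≤ c) (h : ∀ s, c * φ s ≤ ψ s) :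
    (fun s => c * φ s) ∈ B0 K := by
  refine ⟨hφ.1.const_mul c, ?_, ?_⟩
  · have := hφ.2.1.image (fun x => c * x)
    rwa [← Set.range_comp] at this
  · rintro _ ⟨s, rfl⟩
    exact hK.ordConnected.out hmin.1 (hψ.2.2 ⟨s, rfl⟩)
      ⟨mul_nonneg hc (B0.nonneg hmin hφ s), h s⟩

theorem B0.bddAbove_mul {K : Set ℝ} {w ψ : S → ℝ} (hw : (Set.range w).Finite) (hψ : ψ ∈ B0 K) :
    BddAbove (Set.range fun s => w s * ψ s) := by
  refine ((Set.Finite.image2 (fun a b : ℝ => a * b) hw hψ.2.1).subset ?_).bddAbove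
  rintro _ ⟨s, rfl⟩
  exact ⟨w s, ⟨s, rfl⟩, ψ s, ⟨s, rfl⟩, rfl⟩

theorem B0.bddBelow_mul {K : Set ℝ} (hmin : IsLeast K 0) {T : Set S} {w ψ : S → ℝ}
    (hw : ∀ s, 0 ≤ w s) (hψ : ψ ∈ B0 K) :
    BddBelow (Set.range fun s : T => w s * ψ s) := by
  refine ⟨0, ?_⟩
  rintro _ ⟨s, rfl⟩
  exact mul_nonneg (hw s) (B0.nonneg hmin hψ s)

theorem monotone_sublinear_iSup {K : Set ℝ} (hmin : IsLeast K 0) {w : S → ℝ}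
    (hw : (Set.range w).Finite) (hw0 : ∀ s, 0 ≤ w s) :
    MonotoneOnB0 K (fun ψ : S → ℝ => ⨆ s, w s * ψ s) ∧
      SublinearOnB0 K (fun ψ : S → ℝ => ⨆ s, w s * ψ s) := by
  refine ⟨fun φ hφ ψ hψ h => ?_, fun c hc φ hφ _ => ?_, fun φ hφ ψ hψ _ => ?_⟩
  · exact ciSup_mono (B0.bddAbove_mul hw hφ) fun s => mul_le_mul_of_nonneg_left (h s) (hw0 s)
  · simp only [Real.mul_iSup_of_nonneg hc.le]
    exact iSup_congr fun s => by ring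
  · refine Real.iSup_le (fun s => ?_) (add_nonneg ?_ ?_)
    · rw [mul_add]
      exact add_le_add (le_ciSup (B0.bddAbove_mul hw hφ) s) (le_ciSup (B0.bddAbove_mul hw hψ) s)
    · exact Real.iSup_nonneg fun s => mul_nonneg (hw0 s) (B0.nonneg hmin hφ s)
    · exact Real.iSup_nonneg fun s => mul_nonneg (hw0 s) (B0.nonneg hmin hψ s)

theorem monotone_superlinear_iInf {K : Set ℝ} (hmin : IsLeast K 0) (T : Set S) {w : S → ℝ}
    (hw0 : ∀ s, 0 ≤ w s) :
    MonotoneOnB0 K (fun ψ : S → ℝ => ⨅ s : T, w s * ψ s) ∧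
      SuperlinearOnB0 K (fun ψ : S → ℝ => ⨅ s : T, w s * ψ s) := by
  refine ⟨fun φ hφ ψ hψ h => ?_, fun c hc φ hφ _ => ?_, fun φ hφ ψ hψ _ => ?_⟩
  · exact ciInf_mono (B0.bddBelow_mul hmin hw0 hψ)
      fun s => mul_le_mul_of_nonneg_left (h s) (hw0 s)
  · simp only [Real.mul_iInf_of_nonneg hc.le]
    exact iInf_congr fun s => by ring
  · cases isEmpty_or_nonempty T
    · simp
    · refine le_ciInf fun s => ?_
      rw [mul_add]
      exact add_le_add (ciInf_le (B0.bddBelow_mul hmin hw0 hφ) s)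
        (ciInf_le (B0.bddBelow_mul hmin hw0 hψ) s)

section Representation

variable {K : Set ℝ} {I : (S → ℝ) → ℝ}

theorem B0.apply_nonneg (hmin : IsLeast K 0) (hM : MonotoneOnB0 K I) (hN : NormalizedOnB0 K I)
    {φ : S → ℝ} (hφ : φ ∈ B0 K) : 0 ≤ I φ := by
  have := hM φ hφ _ (B0.const_mem hmin.1) (B0.nonneg hmin hφ)
  rwa [hN 0 hmin.1] at this

theorem B0.apply_zero (hmin : IsLeast K 0) (hN : NormalizedOnB0 K I) {φ : S → ℝ}
    (h : ∀ s, φ s = 0) : I φ = 0 := by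
  rw [show φ = fun _ => 0 from funext h, hN 0 hmin.1]

theorem B0.apply_le (hM : MonotoneOnB0 K I) (hN : NormalizedOnB0 K I) {φ : S → ℝ}
    (hφ : φ ∈ B0 K) {s : S} (h : ∀ t, φ t ≤ φ s) : I φ ≤ φ s := by
  have hs : φ s ∈ K := hφ.2.2 ⟨s, rfl⟩
  have := hM _ (B0.const_mem hs) φ hφ h
  rwa [hN _ hs] at this

theorem B0.le_apply (hM : MonotoneOnB0 K I) (hN : NormalizedOnB0 K I) {φ : S → ℝ}
    (hφ : φ ∈ B0 K) {s : S} (h : ∀ t, φ s ≤ φ t) : φ s ≤ I φ := by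
  have hs : φ s ∈ K := hφ.2.2 ⟨s, rfl⟩
  have := hM φ hφ _ (B0.const_mem hs) h
  rwa [hN _ hs] at this

/-- On an empty state space, a normalized functional forces `K` to be trivial. -/
theorem NormalizedOnB0.eq_zero_of_isEmpty [IsEmpty S] (hmin : IsLeast K 0)
    (hN : NormalizedOnB0 K I) {k : ℝ} (hk : k ∈ K) : k = 0 := by
  rw [← hN k hk]
  exact B0.apply_zero hmin hN fun s => isEmptyElim s

theorem exists_sublinear_support (hK : Convex ℝ K) (hmin : IsLeast K 0)
    (hM : MonotoneOnB0 K I) (hN : NormalizedOnB0 K I) (hS : PosSuperhom K I)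
    {φ : S → ℝ} (hφ : φ ∈ B0 K) :
    ∃ J : (S → ℝ) → ℝ, (MonotoneOnB0 K J ∧ SublinearOnB0 K J) ∧
      (∀ ψ ∈ B0 K, (∀ s, ψ s ≤ φ s) → I ψ ≤ J ψ) ∧ (∀ k ∈ K, k ≤ J fun _ => k) ∧
      J φ = I φ := by
  classical
  have hI := B0.apply_nonneg hmin hM hN hφ
  have hφ0 := B0.nonneg hmin hφ
  let w : S → ℝ := fun s => if φ s = 0 then 1 else I φ / φ s
  have hw0 : ∀ s, 0 ≤ w s := fun s => by
    dsimp only [w]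
    split_ifs
    · exact zero_le_one
    · exact div_nonneg hI (hφ0 s)
  have hw : (Set.range w).Finite := by
    have := hφ.2.1.image (fun x => if x = 0 then 1 else I φ / x)
    rwa [← Set.range_comp] at this
  have hwφ : ∀ s, φ s ≠ 0 → w s = I φ / φ s := fun s hs => by simp [w, hs]
  refine ⟨fun ψ => ⨆ s, w s * ψ s, monotone_sublinear_iSup hmin hw hw0, ?_, ?_, ?_⟩
  · intro ψ hψ h
    have hψ0 := B0.nonneg hmin hψ
    have hJ : ∀ s, w s * ψ s ≤ ⨆ s, w s * ψ s := le_ciSup (B0.bddAbove_mul hw hψ)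
    have hJ0 : 0 ≤ ⨆ s, w s * ψ s := Real.iSup_nonneg fun s => mul_nonneg (hw0 s) (hψ0 s)
    have hle := hM φ hφ ψ hψ h
    show I ψ ≤ ⨆ s, w s * ψ s
    generalize (⨆ s, w s * ψ s) = j at hJ hJ0 ⊢
    rcases le_or_gt (I φ) j with hj | hj
    · exact hle.trans hj
    have hpos : 0 < I φ := hJ0.trans_lt hj
    have hdom : ∀ s, ψ s ≤ j / I φ * φ s := fun s => by
      by_cases hs : φ s = 0
      · rw [hs, mul_zero]
        exact (h s).trans hs.le
      · have hs' : 0 < φ s := (hφ0 s).lt_of_ne' hs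
        have := hJ s
        rw [hwφ s hs, div_mul_eq_mul_div, div_le_iff₀ hs'] at this
        rw [div_mul_eq_mul_div, le_div_iff₀ hpos]
        linarith
    rcases hJ0.eq_or_lt with rfl | hj0
    · refine (B0.apply_zero hmin hN fun s => le_antisymm ?_ (hψ0 s)).le
      simpa using hdom s
    · have hlt : j / I φ < 1 := (div_lt_one hpos).2 hj
      have hmem : (fun s => j / I φ * φ s) ∈ B0 K :=
        B0.mul_mem hK hmin hφ hφ (by positivity)
          fun s => mul_le_of_le_one_left (hφ0 s) hlt.le
      calc I ψ ≤ I fun s => j / I φ * φ s := hM _ hmem ψ hψ hdom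
        _ ≤ j / I φ * I φ := hS _ ⟨by positivity, hlt⟩ φ hφ hmem
        _ = j := div_mul_cancel₀ _ hpos.ne'
  · intro k hk
    cases isEmpty_or_nonempty S
    · rw [hN.eq_zero_of_isEmpty hmin hk]
      simp
    · obtain ⟨s, hs⟩ := B0.exists_min hφ
      refine le_trans ?_ (le_ciSup (B0.bddAbove_mul hw (B0.const_mem hk)) s)
      refine le_mul_of_one_le_left (hmin.2 hk) ?_
      by_cases h0 : φ s = 0
      · simp [w, h0]
      · rw [hwφ s h0, one_le_div ((hφ0 s).lt_of_ne' h0)]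
        exact B0.le_apply hM hN hφ hs
  · by_cases h : ∀ s, φ s = 0
    · rw [B0.apply_zero hmin hN h]
      simp [h]
    · push Not at h
      obtain ⟨s, hs⟩ := h
      refine le_antisymm (Real.iSup_le (fun t => ?_) hI) ?_
      · by_cases ht : φ t = 0
        · simpa [ht] using hI
        · rw [hwφ t ht, div_mul_cancel₀ _ ht]
      · refine le_trans ?_ (le_ciSup (B0.bddAbove_mul hw hφ) s)
        rw [hwφ s hs, div_mul_cancel₀ _ hs]

theorem exists_superlinear_support (hK : Convex ℝ K) (hmin : IsLeast K 0)
    (hM : MonotoneOnB0 K I) (hN : NormalizedOnB0 K I) (hS : PosSuperhom K I)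
    {φ : S → ℝ} (hφ : φ ∈ B0 K) :
    ∃ H : (S → ℝ) → ℝ, (MonotoneOnB0 K H ∧ SuperlinearOnB0 K H) ∧
      (∀ ψ ∈ B0 K, (∀ s, φ s ≤ ψ s) → H ψ ≤ I ψ) ∧ (∀ k ∈ K, (H fun _ => k) ≤ k) ∧
      H φ = I φ := by
  have hI := B0.apply_nonneg hmin hM hN hφ
  have hφ0 := B0.nonneg hmin hφ
  have hw0 : ∀ s, 0 ≤ I φ / φ s := fun s => div_nonneg hI (hφ0 s)
  let T : Set S := {s | φ s ≠ 0}
  refine ⟨fun ψ => ⨅ s : T, I φ / φ s * ψ s, monotone_superlinear_iInf hmin T hw0, ?_, ?_, ?_⟩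
  · intro ψ hψ h
    have hψ0 := B0.nonneg hmin hψ
    have hJ : ∀ s : T, (⨅ s : T, I φ / φ s * ψ s) ≤ I φ / φ s * ψ s :=
      ciInf_le (B0.bddBelow_mul hmin hw0 hψ)
    have hle := hM ψ hψ φ hφ h
    show (⨅ s : T, I φ / φ s * ψ s) ≤ I ψ
    rcases hI.eq_or_lt with h0 | hpos
    · simpa [← h0] using B0.apply_nonneg hmin hM hN hψ
    generalize (⨅ s : T, I φ / φ s * ψ s) = j at hJ ⊢
    rcases le_or_gt j (I φ) with hj | hj
    · exact hj.trans hle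
    have hj0 : 0 < j := hpos.trans hj
    have hdom : ∀ s, j / I φ * φ s ≤ ψ s := fun s => by
      by_cases hs : φ s = 0
      · rw [hs, mul_zero]
        exact hψ0 s
      · have hs' : 0 < φ s := (hφ0 s).lt_of_ne' hs
        have := hJ ⟨s, hs⟩
        rw [div_mul_eq_mul_div, le_div_iff₀ hs'] at this
        rw [div_mul_eq_mul_div, div_le_iff₀ hpos]
        linarith
    have hmem : (fun s => j / I φ * φ s) ∈ B0 K :=
      B0.mul_mem hK hmin hφ hψ (by positivity) hdom
    have hscale : (fun s => I φ / j * (j / I φ * φ s)) = φ := by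
      funext s
      field_simp
    have hsup := hS (I φ / j) ⟨by positivity, (div_lt_one hj0).2 hj⟩ _ hmem
      (by rwa [hscale])
    rw [hscale, div_mul_eq_mul_div, le_div_iff₀ hj0] at hsup
    exact (le_of_mul_le_mul_left hsup hpos).trans (hM ψ hψ _ hmem hdom)
  · intro k hk
    cases isEmpty_or_nonempty T with
    | inl _ => simpa using hmin.2 hk
    | inr hT =>
      obtain ⟨t, ht⟩ := hT
      have : Nonempty S := ⟨t⟩
      obtain ⟨s, hs⟩ := B0.exists_max hφ
      have hpos : 0 < φ s := ((hφ0 t).lt_of_ne' ht).trans_le (hs t)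
      refine (ciInf_le (B0.bddBelow_mul hmin hw0 (B0.const_mem hk)) (⟨s, hpos.ne'⟩ : T)).trans ?_
      exact mul_le_of_le_one_left (hmin.2 hk) ((div_le_one hpos).2 (B0.apply_le hM hN hφ hs))
  · have hT : ∀ s : T, I φ / φ s * φ s = I φ := fun s => div_mul_cancel₀ _ s.2
    simp only [hT]
    cases isEmpty_or_nonempty T with
    | inl hE =>
      rw [Real.iInf_of_isEmpty]
      exact (B0.apply_zero hmin hN fun s => by_contra fun hs => hE.elim ⟨s, hs⟩).symm
    | inr _ => exact ciInf_const

theorem exists_normalized_sublinear_ge (hmin : IsLeast K 0) (hM : MonotoneOnB0 K I)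
    (hN : NormalizedOnB0 K I) :
    ∃ J : (S → ℝ) → ℝ, (MonotoneOnB0 K J ∧ SublinearOnB0 K J) ∧
      (∀ ψ ∈ B0 K, I ψ ≤ J ψ) ∧ NormalizedOnB0 K J := by
  have hw : (Set.range fun _ : S => (1 : ℝ)).Finite := Set.finite_range_const
  refine ⟨_, monotone_sublinear_iSup hmin hw fun _ => zero_le_one, fun ψ hψ => ?_,
    fun k hk => ?_⟩ <;> cases isEmpty_or_nonempty S
  · simpa using (B0.apply_zero hmin hN fun s => isEmptyElim s).le
  · obtain ⟨s, hs⟩ := B0.exists_max hψ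
    refine le_trans ?_ (le_ciSup (B0.bddAbove_mul hw hψ) s)
    simpa using B0.apply_le hM hN hψ hs
  · simpa using (hN.eq_zero_of_isEmpty hmin hk).symm
  · simp

theorem exists_normalized_superlinear_le (hmin : IsLeast K 0) (hM : MonotoneOnB0 K I)
    (hN : NormalizedOnB0 K I) :
    ∃ H : (S → ℝ) → ℝ, (MonotoneOnB0 K H ∧ SuperlinearOnB0 K H) ∧
      (∀ ψ ∈ B0 K, H ψ ≤ I ψ) ∧ NormalizedOnB0 K H := by
  have hw : ∀ _ : S, (0 : ℝ) ≤ 1 := fun _ => zero_le_one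
  refine ⟨_, monotone_superlinear_iInf hmin Set.univ hw, fun ψ hψ => ?_,
    fun k hk => ?_⟩ <;> cases isEmpty_or_nonempty S
  · simpa using B0.apply_nonneg hmin hM hN hψ
  · obtain ⟨s, hs⟩ := B0.exists_min hψ
    refine (ciInf_le (B0.bddBelow_mul hmin hw hψ) (⟨s, trivial⟩ : Set.univ)).trans ?_
    simpa using B0.le_apply hM hN hψ hs
  · simpa using (hN.eq_zero_of_isEmpty hmin hk).symm
  · simp

end Representation

/-- for a convex `K ⊆ ℝ` with `min K = 0` and a continuous
`I : B₀(Σ,K) → ℝ`, the following are equivalent: (i) `I` is monotone, normalized, and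
positively superhomogeneous; (ii) act-dependent minimum representation via monotone sublinear
functionals, with families enlarging as the act decreases; (iii) act-dependent maximum
representation via monotone superlinear functionals, with families enlarging as the act
increases. -/
theorem stmt_17 (K : Set ℝ) (hK : Convex ℝ K) (hmin : IsLeast K 0) (I : (S → ℝ) → ℝ)
    (hcont : SupNormContinuous K I) :
    ((MonotoneOnB0 K I ∧ NormalizedOnB0 K I ∧ PosSuperhom K I) ↔
      (∃ Φ : (S → ℝ) → Set ((S → ℝ) → ℝ),
        (∀ φ : S → ℝ, φ ∈ B0 K → ∀ J ∈ Φ φ, MonotoneOnB0 K J ∧ SublinearOnB0 K J) ∧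
        (∀ φ : S → ℝ, φ ∈ B0 K → (∀ J ∈ Φ φ, I φ ≤ J φ) ∧ ∃ J ∈ Φ φ, J φ = I φ) ∧
        (∀ φ : S → ℝ, φ ∈ B0 K → ∀ k ∈ K,
          (∀ J ∈ Φ φ, k ≤ J (fun _ => k)) ∧ ∃ J ∈ Φ φ, J (fun _ => k) = k) ∧
        (∀ φ₁ : S → ℝ, φ₁ ∈ B0 K → ∀ φ₂ : S → ℝ, φ₂ ∈ B0 K →
          (∀ s, φ₂ s ≤ φ₁ s) → Φ φ₁ ⊆ Φ φ₂))) ∧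
    ((MonotoneOnB0 K I ∧ NormalizedOnB0 K I ∧ PosSuperhom K I) ↔
      (∃ Ψ : (S → ℝ) → Set ((S → ℝ) → ℝ),
        (∀ φ : S → ℝ, φ ∈ B0 K → ∀ H ∈ Ψ φ, MonotoneOnB0 K H ∧ SuperlinearOnB0 K H) ∧
        (∀ φ : S → ℝ, φ ∈ B0 K → (∀ H ∈ Ψ φ, H φ ≤ I φ) ∧ ∃ H ∈ Ψ φ, H φ = I φ) ∧
        (∀ φ : S → ℝ, φ ∈ B0 K → ∀ k ∈ K,
          (∀ H ∈ Ψ φ, H (fun _ => k) ≤ k) ∧ ∃ H ∈ Ψ φ, H (fun _ => k) = k) ∧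
        (∀ φ₁ : S → ℝ, φ₁ ∈ B0 K → ∀ φ₂ : S → ℝ, φ₂ ∈ B0 K →
          (∀ s, φ₁ s ≤ φ₂ s) → Ψ φ₁ ⊆ Ψ φ₂))) := by
  refine ⟨⟨?_, ?_⟩, ?_, ?_⟩
  · rintro ⟨hM, hN, hS⟩
    refine ⟨fun φ => {J | (MonotoneOnB0 K J ∧ SublinearOnB0 K J) ∧
      (∀ ψ ∈ B0 K, (∀ s, ψ s ≤ φ s) → I ψ ≤ J ψ) ∧ ∀ k ∈ K, k ≤ J fun _ => k},
      fun φ _ J hJ => hJ.1, fun φ hφ => ⟨fun J hJ => hJ.2.1 φ hφ fun _ => le_rfl, ?_⟩,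
      fun φ _ k hk => ⟨fun J hJ => hJ.2.2 k hk, ?_⟩,
      fun φ₁ _ φ₂ _ h J hJ =>
        ⟨hJ.1, fun ψ hψ hle => hJ.2.1 ψ hψ fun s => (hle s).trans (h s), hJ.2.2⟩⟩
    · obtain ⟨J, h₁, h₂, h₃, h₄⟩ := exists_sublinear_support hK hmin hM hN hS hφ
      exact ⟨J, ⟨h₁, h₂, h₃⟩, h₄⟩
    · obtain ⟨J, h₁, h₂, h₃⟩ := exists_normalized_sublinear_ge hmin hM hN
      exact ⟨J, ⟨h₁, fun ψ hψ _ => h₂ ψ hψ, fun k hk => (h₃ k hk).ge⟩, h₃ k hk⟩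
  · rintro ⟨Φ, hΦ, hrep, hnorm, hmono⟩
    refine ⟨fun φ hφ ψ hψ h => ?_, fun k hk => ?_, fun γ hγ φ hφ hγφ => ?_⟩
    · obtain ⟨J, hJ, hJφ⟩ := (hrep φ hφ).2
      rw [← hJφ]
      exact ((hrep ψ hψ).1 J (hmono φ hφ ψ hψ h hJ)).trans ((hΦ φ hφ J hJ).1 φ hφ ψ hψ h)
    · have hkB : (fun _ : S => k) ∈ B0 K := B0.const_mem hk
      obtain ⟨J, hJ, hJI⟩ := (hrep _ hkB).2
      obtain ⟨J', hJ', hJk⟩ := (hnorm _ hkB k hk).2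
      exact le_antisymm (((hrep _ hkB).1 J' hJ').trans hJk.le)
        (((hnorm _ hkB k hk).1 J hJ).trans hJI.le)
    · obtain ⟨J, hJ, hJφ⟩ := (hrep φ hφ).2
      have hle : ∀ s, γ * φ s ≤ φ s := fun s =>
        mul_le_of_le_one_left (B0.nonneg hmin hφ s) hγ.2.le
      rw [← hJφ, ← (hΦ φ hφ J hJ).2.1 γ hγ.1 φ hφ hγφ]
      exact (hrep _ hγφ).1 J (hmono φ hφ _ hγφ hle hJ)
  · rintro ⟨hM, hN, hS⟩
    refine ⟨fun φ => {H | (MonotoneOnB0 K H ∧ SuperlinearOnB0 K H) ∧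
      (∀ ψ ∈ B0 K, (∀ s, φ s ≤ ψ s) → H ψ ≤ I ψ) ∧ ∀ k ∈ K, (H fun _ => k) ≤ k},
      fun φ _ H hH => hH.1, fun φ hφ => ⟨fun H hH => hH.2.1 φ hφ fun _ => le_rfl, ?_⟩,
      fun φ _ k hk => ⟨fun H hH => hH.2.2 k hk, ?_⟩,
      fun φ₁ _ φ₂ _ h H hH =>
        ⟨hH.1, fun ψ hψ hle => hH.2.1 ψ hψ fun s => (h s).trans (hle s), hH.2.2⟩⟩
    · obtain ⟨H, h₁, h₂, h₃, h₄⟩ := exists_superlinear_support hK hmin hM hN hS hφ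
      exact ⟨H, ⟨h₁, h₂, h₃⟩, h₄⟩
    · obtain ⟨H, h₁, h₂, h₃⟩ := exists_normalized_superlinear_le hmin hM hN
      exact ⟨H, ⟨h₁, fun ψ hψ _ => h₂ ψ hψ, fun k hk => (h₃ k hk).le⟩, h₃ k hk⟩
  · rintro ⟨Ψ, hΨ, hrep, hnorm, hmono⟩
    refine ⟨fun φ hφ ψ hψ h => ?_, fun k hk => ?_, fun γ hγ φ hφ hγφ => ?_⟩
    · obtain ⟨H, hH, hHψ⟩ := (hrep ψ hψ).2
      rw [← hHψ]
      exact ((hΨ ψ hψ H hH).1 φ hφ ψ hψ h).trans ((hrep φ hφ).1 H (hmono ψ hψ φ hφ h hH))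
    · have hkB : (fun _ : S => k) ∈ B0 K := B0.const_mem hk
      obtain ⟨H, hH, hHI⟩ := (hrep _ hkB).2
      obtain ⟨H', hH', hHk⟩ := (hnorm _ hkB k hk).2
      exact le_antisymm (hHI.ge.trans ((hnorm _ hkB k hk).1 H hH))
        (hHk.ge.trans ((hrep _ hkB).1 H' hH'))
    · obtain ⟨H, hH, hHφ⟩ := (hrep _ hγφ).2
      have hle : ∀ s, γ * φ s ≤ φ s := fun s =>
        mul_le_of_le_one_left (B0.nonneg hmin hφ s) hγ.2.le
      rw [← hHφ, (hΨ _ hγφ H hH).2.1 γ hγ.1 φ hφ hγφ]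
      exact mul_le_mul_of_nonneg_left ((hrep φ hφ).1 H (hmono _ hγφ φ hφ hle hH)) hγ.1.le
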